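/- Commutation of rewrite steps and equivalence for pattern-general terms: Let ρ be a left-linear constrained rewrite rule and let ⟨X, s, ∃x⃗.φ⟩ and ⟨Y, t, ∃y⃗.ψ⟩ be satisfiable, pattern-general existentially constrained terms. If ⟨X', s', ∃x⃗'.φ'⟩ ←_ρ ⟨X, s, ∃x⃗.φ⟩ ∼ ⟨Y, t, ∃y⃗.ψ⟩ (a most general rewrite step from ⟨X, s, ∃x⃗.φ⟩ and an equivalence to ⟨Y, t, ∃y⃗.ψ⟩), then there exists an existentially constrained term ⟨Y', t', ∃y⃗'.ψ'⟩ such that ⟨X', s', ∃x⃗'.φ'⟩ ∼ ⟨Y', t', ∃y⃗'.ψ'⟩ ←_ρ ⟨Y, t, ∃y⃗.ψ⟩. -/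

import Mathlib

namespace LCTRS

open scoped Classical

noncomputable section

/-- First-order terms over function symbols `F` and variables `V`. -/
inductive Term (F V : Type) : Type where
  | var : V → Term F V
  | app : F → List (Term F V) → Term F V

variable {F V D : Type}

/-- Occurrence of a variable in a term. -/
inductive Term.VarIn (x : V) : Term F V → Prop where
  | var : Term.VarIn x (Term.var x)
  | app {f : F} {ts : List (Term F V)} {t : Term F V} :
      t ∈ ts → Term.VarIn x t → Term.VarIn x (Term.app f ts)

/-- The set of variables occurring in a term. -/
def Term.vars (t : Term F V) : Set V := {x | Term.VarIn x t}

/-- Application of a substitution to a term. -/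
def Term.subst (t : Term F V) (σ : V → Term F V) : Term F V :=
  match t with
  | .var x => σ x
  | .app f ts => .app f (ts.attach.map (fun u => u.1.subst σ))
decreasing_by
  have := List.sizeOf_lt_of_mem u.2
  simp only [Term.app.sizeOf_spec] at *
  omega

/-- The domain of a substitution. -/
def substDom (σ : V → Term F V) : Set V := {x | σ x ≠ Term.var x}

/-- Positions in a term. -/
abbrev Pos := List Nat

/-- `SubtermAt s p u`: the subterm of `s` at position `p` exists and equals `u`. -/
inductive SubtermAt : Term F V → Pos → Term F V → Prop where
  | refl (t : Term F V) : SubtermAt t [] t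
  | app {f : F} {ts : List (Term F V)} {i : Nat} {t u : Term F V} {p : Pos} :
      ts[i]? = some t → SubtermAt t p u → SubtermAt (Term.app f ts) (i :: p) u

/-- `ReplaceAt s p u t`: replacing the subterm of `s` at position `p` by `u` yields `t`. -/
inductive ReplaceAt : Term F V → Pos → Term F V → Term F V → Prop where
  | here (t u : Term F V) : ReplaceAt t [] u u
  | app {f : F} {ts : List (Term F V)} {i : Nat} {p : Pos} {u t t' : Term F V} :
      ts[i]? = some t → ReplaceAt t p u t' →
      ReplaceAt (Term.app f ts) (i :: p) u (Term.app f (ts.set i t'))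

/-- Replacement at a list of pairwise parallel positions (performed sequentially). -/
inductive ReplaceList : Term F V → List Pos → List (Term F V) → Term F V → Prop where
  | nil (t : Term F V) : ReplaceList t [] [] t
  | cons {t t₁ t₂ : Term F V} {p : Pos} {ps : List Pos} {u : Term F V} {us : List (Term F V)} :
      ReplaceAt t p u t₁ → ReplaceList t₁ ps us t₂ → ReplaceList t (p :: ps) (u :: us) t₂

/-- A term is linear if each variable occurs at most once in it. -/
def Term.Linear (t : Term F V) : Prop :=
  ∀ (x : V) (p q : Pos), SubtermAt t p (Term.var x) → SubtermAt t q (Term.var x) → p = q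

/-- A term is `X`-linear if each variable of `X` occurs at most once in it. -/
def Term.LinearOn (t : Term F V) (X : Set V) : Prop :=
  ∀ x ∈ X, ∀ (p q : Pos), SubtermAt t p (Term.var x) → SubtermAt t q (Term.var x) → p = q

/-- A model over the (theory part of the) signature: an interpretation of the function
symbols over a domain `D`, a designated truth value, a set `Val` of value constants such
that every domain element is denoted by some value, and designated conjunction, equality
and truth symbols interpreted as expected. -/
structure Model (F V D : Type) where
  interp : F → List D → D
  tval : D
  Val : Set F
  andSym : F
  eqSym : F
  trueSym : F
  val_const : ∀ v ∈ Val, ∀ ds : List D, interp v ds = interp v []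
  val_surj : ∀ d : D, ∃ v ∈ Val, interp v [] = d
  and_spec : ∀ a b : D, (interp andSym [a, b] = tval ↔ (a = tval ∧ b = tval))
  eq_spec : ∀ a b : D, (interp eqSym [a, b] = tval ↔ a = b)
  true_spec : interp trueSym [] = tval

/-- Evaluation of a term in a model under a valuation. -/
def Model.eval (M : Model F V D) (ξ : V → D) (t : Term F V) : D :=
  match t with
  | .var x => ξ x
  | .app f ts => M.interp f (ts.attach.map (fun u => M.eval ξ u.1))
decreasing_by
  have := List.sizeOf_lt_of_mem u.2
  simp only [Term.app.sizeOf_spec] at *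
  omega

/-- A constraint holds in `M` under the valuation `ξ`. -/
def Model.holds (M : Model F V D) (ξ : V → D) (φ : Term F V) : Prop := M.eval ξ φ = M.tval

/-- `⊨_M φ`: the constraint `φ` holds under every valuation. -/
def Model.validC (M : Model F V D) (φ : Term F V) : Prop := ∀ ξ : V → D, M.holds ξ φ

/-- `t` is a value (a constant from `Val`). -/
def Model.IsValueTerm (M : Model F V D) (t : Term F V) : Prop := ∃ v ∈ M.Val, t = Term.app v []

/-- The root symbol of `t` is a value symbol. -/
def Model.IsValueSym (M : Model F V D) (t : Term F V) : Prop :=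
  ∃ v ∈ M.Val, ∃ ts : List (Term F V), t = Term.app v ts

/-- No value occurs in `t`. -/
def Term.ValueFree (t : Term F V) (M : Model F V D) : Prop :=
  ∀ (p : Pos) (u : Term F V), SubtermAt t p u → ¬ M.IsValueSym u

/-- The conjunction `φ ∧ ψ` as a constraint. -/
def Model.conj (M : Model F V D) (φ ψ : Term F V) : Term F V := Term.app M.andSym [φ, ψ]

/-- The equation `s = t` as a constraint. -/
def Model.eqc (M : Model F V D) (s t : Term F V) : Term F V := Term.app M.eqSym [s, t]

/-- The constraint `true`. -/
def Model.trueC (M : Model F V D) : Term F V := Term.app M.trueSym []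

/-- `φ ∧ ψ₁ ∧ ⋯ ∧ ψₙ`. -/
def Model.conjFrom (M : Model F V D) (φ : Term F V) (l : List (Term F V)) : Term F V :=
  l.foldl M.conj φ

/-- `ψ₁ ∧ ⋯ ∧ ψₙ`. -/
def Model.bigConj (M : Model F V D) (l : List (Term F V)) : Term F V :=
  l.foldl M.conj M.trueC

/-- An existential constraint `⟨∃x⃗. φ⟩`: a set of (bound) variables together with a
constraint. -/
structure EC (F V : Type) where
  bvars : Set V
  constr : Term F V

/-- Well-formedness of an existential constraint: `{x⃗} ⊆ Var(φ)`. -/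
def EC.WF (c : EC F V) : Prop := c.bvars ⊆ c.constr.vars

/-- Free variables of an existential constraint. -/
def EC.fvars (c : EC F V) : Set V := c.constr.vars \ c.bvars

/-- `⟨∃x⃗. φ⟩` holds under valuation `ξ`: `φκ` holds under `ξ` for some substitution `κ`
mapping `x⃗` into `Val` (and the identity elsewhere). -/
def EC.holdsUnder (c : EC F V) (M : Model F V D) (ξ : V → D) : Prop :=
  ∃ κ : V → Term F V, (∀ x ∈ c.bvars, M.IsValueTerm (κ x)) ∧
    (∀ x ∉ c.bvars, κ x = Term.var x) ∧ M.holds ξ (c.constr.subst κ)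

/-- `⊨_M ⟨∃x⃗. φ⟩`. -/
def EC.validM (c : EC F V) (M : Model F V D) : Prop := ∀ ξ : V → D, c.holdsUnder M ξ

/-- Satisfiability of an existential constraint. -/
def EC.satisfiable (c : EC F V) (M : Model F V D) : Prop := ∃ ξ : V → D, c.holdsUnder M ξ

/-- Application of a substitution to an existential constraint acts on the free
variables only. -/
def EC.subst (c : EC F V) (σ : V → Term F V) : EC F V :=
  ⟨c.bvars, c.constr.subst (fun x => if x ∈ c.bvars then Term.var x else σ x)⟩

/-- `⊨_M ⟨∃x⃗.φ⟩ ⇔ ⟨∃y⃗.ψ⟩`. -/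
def ECIffM (M : Model F V D) (c c' : EC F V) : Prop :=
  ∀ ξ : V → D, c.holdsUnder M ξ ↔ c'.holdsUnder M ξ

/-- `σ ⊨_M ⟨∃x⃗.φ⟩`: `σ` maps the free variables into values and `(⟨∃x⃗.φ⟩)σ` is valid. -/
def SubstRespectsEC (M : Model F V D) (σ : V → Term F V) (c : EC F V) : Prop :=
  (∀ x ∈ c.fvars, M.IsValueTerm (σ x)) ∧ (c.subst σ).validM M

/-- `σ` respects the plain constraint `φ`. -/
def SubstRespects (M : Model F V D) (σ : V → Term F V) (φ : Term F V) : Prop :=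
  (∀ x ∈ φ.vars, M.IsValueTerm (σ x)) ∧ M.validC (φ.subst σ)

/-- An existentially constrained term `⟨X, s, ∃x⃗.φ⟩`. -/
structure ECTerm (F V : Type) where
  lvars : Set V
  term : Term F V
  ec : EC F V

/-- Well-formedness: `{x⃗} ⊆ Var(φ)`, `FVar(⟨∃x⃗.φ⟩) ⊆ X ⊆ Var(s)` and `{x⃗} ∩ Var(s) = ∅`. -/
def ECTerm.WF (T : ECTerm F V) : Prop :=
  T.ec.WF ∧ T.ec.fvars ⊆ T.lvars ∧ T.lvars ⊆ T.term.vars ∧ ∀ x ∈ T.ec.bvars, x ∉ T.term.vars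

/-- Satisfiability of an existentially constrained term. -/
def ECTerm.satisfiable (T : ECTerm F V) (M : Model F V D) : Prop := T.ec.satisfiable M

/-- `T` is subsumed by `T'`. -/
def SubsumedBy (M : Model F V D) (T T' : ECTerm F V) : Prop :=
  ∀ σ : V → Term F V, (∀ x ∈ T.lvars, M.IsValueTerm (σ x)) → SubstRespectsEC M σ T.ec →
    ∃ γ : V → Term F V, (∀ y ∈ T'.lvars, M.IsValueTerm (γ y)) ∧ SubstRespectsEC M γ T'.ec ∧
      T.term.subst σ = T'.term.subst γ

/-- Equivalence of existentially constrained terms. -/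
def ECEquiv (M : Model F V D) (T T' : ECTerm F V) : Prop :=
  SubsumedBy M T T' ∧ SubsumedBy M T' T

/-- An existentially constrained term is pattern-general if its term is linear in its
logical variables and contains no value. -/
def ECTerm.PatternGeneral (T : ECTerm F V) (M : Model F V D) : Prop :=
  T.term.LinearOn T.lvars ∧ T.term.ValueFree M

/-- A constrained rewrite rule `Π Z. ℓ → r [π]`. -/
structure Rule (F V : Type) where
  Z : Set V
  lhs : Term F V
  rhs : Term F V
  constr : Term F V

/-- `Var(ρ)`. -/
def Rule.vars (ρ : Rule F V) : Set V := ρ.lhs.vars ∪ ρ.rhs.vars ∪ ρ.constr.vars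

/-- `ExVar(ρ) = Var(r) \ Var(ℓ)`. -/
def Rule.exVars (ρ : Rule F V) : Set V := ρ.rhs.vars \ ρ.lhs.vars

/-- Well-formedness of a rule: `(Var(r) \ Var(ℓ)) ∪ Var(π) ⊆ Z ⊆ Var(ℓ,r,π)`. -/
def Rule.WF (ρ : Rule F V) : Prop :=
  (ρ.rhs.vars \ ρ.lhs.vars) ∪ ρ.constr.vars ⊆ ρ.Z ∧ ρ.Z ⊆ ρ.vars

/-- Left-linearity. -/
def Rule.LeftLinear (ρ : Rule F V) : Prop := ρ.lhs.Linear

/-- A rule is left-value-free if it is left-linear and no value occurs in its lhs. -/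
def Rule.LeftValueFree (ρ : Rule F V) (M : Model F V D) : Prop :=
  ρ.LeftLinear ∧ ρ.lhs.ValueFree M

/-- `ρ'` is a renamed variant of `ρ`. -/
def Rule.IsVariantOf (ρ' ρ : Rule F V) : Prop :=
  ∃ δ : V → V, Function.Bijective δ ∧
    ρ'.Z = δ '' ρ.Z ∧ ρ'.lhs = ρ.lhs.subst (fun x => Term.var (δ x)) ∧
    ρ'.rhs = ρ.rhs.subst (fun x => Term.var (δ x)) ∧
    ρ'.constr = ρ.constr.subst (fun x => Term.var (δ x))

/-- `⟨X,s,∃x⃗.φ⟩` has a `ρ`-redex at position `p` using substitution `γ`. -/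
structure RedexAt (M : Model F V D) (ρ : Rule F V) (T : ECTerm F V)
    (p : Pos) (γ : V → Term F V) : Prop where
  dom : substDom γ = ρ.lhs.vars
  matchAt : SubtermAt T.term p (ρ.lhs.subst γ)
  lvar : ∀ x ∈ ρ.lhs.vars ∩ ρ.Z, M.IsValueTerm (γ x) ∨ ∃ y ∈ T.lvars, γ x = Term.var y
  implied : ∀ ξ : V → D, T.ec.holdsUnder M ξ →
    EC.holdsUnder ⟨ρ.constr.vars \ ρ.lhs.vars, ρ.constr.subst γ⟩ M ξ

/-- A most general rewrite step at position `p` using substitution `γ`. -/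
structure MGStepData (M : Model F V D) (ρ : Rule F V) (T T' : ECTerm F V)
    (p : Pos) (γ : V → Term F V) : Prop where
  redex : RedexAt M ρ T p γ
  target : ReplaceAt T.term p (ρ.rhs.subst γ) T'.term
  cstr : T'.ec.constr = M.conj T.ec.constr (ρ.constr.subst γ)
  bnd : T'.ec.bvars = T'.ec.constr.vars \ T'.term.vars
  lv : T'.lvars = ρ.exVars ∪ (T.lvars ∩ T'.term.vars)

/-- A most general rewrite step at position `p`. -/
def MGStepAt (M : Model F V D) (ρ : Rule F V) (p : Pos) (T T' : ECTerm F V) : Prop :=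
  ∃ γ : V → Term F V, MGStepData M ρ T T' p γ

/-- A most general rewrite step. -/
def MGStep (M : Model F V D) (ρ : Rule F V) (T T' : ECTerm F V) : Prop :=
  ∃ (p : Pos) (γ : V → Term F V), MGStepData M ρ T T' p γ

/-- A non-quantified constrained term `⟨X, s, φ⟩`. -/
structure NQTerm (F V : Type) where
  lvars : Set V
  term : Term F V
  constr : Term F V

/-- Well-formedness: `Var(φ) ⊆ X ⊆ Var(φ, s)`. -/
def NQTerm.WF (T : NQTerm F V) : Prop :=
  T.constr.vars ⊆ T.lvars ∧ T.lvars ⊆ T.constr.vars ∪ T.term.vars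

/-- Satisfiability of a non-quantified constrained term. -/
def NQTerm.satisfiable (T : NQTerm F V) (M : Model F V D) : Prop :=
  ∃ ξ : V → D, M.holds ξ T.constr

/-- Subsumption of non-quantified constrained terms. -/
def NQSubsumedBy (M : Model F V D) (T T' : NQTerm F V) : Prop :=
  ∀ σ : V → Term F V, (∀ x ∈ T.lvars, M.IsValueTerm (σ x)) → SubstRespects M σ T.constr →
    ∃ γ : V → Term F V, (∀ y ∈ T'.lvars, M.IsValueTerm (γ y)) ∧ SubstRespects M γ T'.constr ∧
      T.term.subst σ = T'.term.subst γ

/-- Equivalence of non-quantified constrained terms. -/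
def NQEquiv (M : Model F V D) (T T' : NQTerm F V) : Prop :=
  NQSubsumedBy M T T' ∧ NQSubsumedBy M T' T

/-- A rewrite step on non-quantified constrained terms at position `p` using `σ`. -/
structure NQStepData (M : Model F V D) (ρ : Rule F V) (T T' : NQTerm F V)
    (p : Pos) (σ : V → Term F V) : Prop where
  fresh : Disjoint ρ.vars (T.lvars ∪ T.term.vars ∪ T.constr.vars)
  funpos : ∃ (f : F) (ts : List (Term F V)), SubtermAt T.term p (Term.app f ts)
  dom : substDom σ = ρ.vars
  matchAt : SubtermAt T.term p (ρ.lhs.subst σ)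
  zval : ∀ x ∈ ρ.Z, M.IsValueTerm (σ x) ∨ ∃ y ∈ T.lvars, σ x = Term.var y
  implied : ∀ ξ : V → D, M.holds ξ T.constr → M.holds ξ (ρ.constr.subst σ)
  target : ReplaceAt T.term p (ρ.rhs.subst σ) T'.term
  cstr : T'.constr = T.constr
  lv : T'.lvars = T.lvars ∩ (T'.term.vars ∪ T.constr.vars)

/-- A rewrite step on non-quantified constrained terms. -/
def NQStep (M : Model F V D) (ρ : Rule F V) (T T' : NQTerm F V) : Prop :=
  ∃ (p : Pos) (σ : V → Term F V), NQStepData M ρ T T' p σ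

/-- The existential removing translation `rmv`. -/
def rmv (T : ECTerm F V) : NQTerm F V := ⟨T.lvars ∪ T.ec.bvars, T.term, T.ec.constr⟩

/-- The existential extension translation `ext`. -/
def ext (T : NQTerm F V) : ECTerm F V :=
  ⟨T.lvars \ (T.constr.vars \ T.term.vars), T.term, ⟨T.constr.vars \ T.term.vars, T.constr⟩⟩

/-- Positions of `s` whose symbol is a variable of `X` or a value. -/
def PosXVal (M : Model F V D) (X : Set V) (s : Term F V) : Set Pos :=
  {p | ∃ u : Term F V, SubtermAt s p u ∧ ((∃ x ∈ X, u = Term.var x) ∨ M.IsValueSym u)}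

/-- `s'` is the bullet translation `s^{•X}` of `s`, obtained by replacing the subterms at
the positions `ps` (which enumerate `Pos_{X∪Val}(s)`) by the pairwise distinct fresh
variables `xs`. -/
structure BulletData (M : Model F V D) (X avoid : Set V) (s : Term F V)
    (ps : List Pos) (xs : List V) (s' : Term F V) : Prop where
  nodup_ps : ps.Nodup
  cover : ∀ p : Pos, p ∈ ps ↔ p ∈ PosXVal M X s
  nodup_xs : xs.Nodup
  len : xs.length = ps.length
  fresh : ∀ x ∈ xs, x ∉ avoid
  repl : ReplaceList s ps (xs.map Term.var) s'

/-- `T'` is the pattern-general translation `PG(T)` of `T` (with fresh variables chosen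
outside `avoid`). -/
def IsPG (M : Model F V D) (avoid : Set V) (T T' : ECTerm F V) : Prop :=
  ∃ (ps : List Pos) (xs : List V) (us : List (Term F V)),
    BulletData M T.lvars avoid T.term ps xs T'.term ∧
    List.Forall₂ (fun p u => SubtermAt T.term p u) ps us ∧
    T'.lvars = {x | x ∈ xs} ∧
    T'.ec.bvars = T.ec.bvars ∪ T.lvars ∧
    T'.ec.constr = M.conjFrom T.ec.constr (List.zipWith M.eqc us (xs.map Term.var))

/-- `ρh` is the left-value-free transformation `lvf(ρ)` of `ρ`. -/
def IsLVF (M : Model F V D) (ρ ρh : Rule F V) : Prop :=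
  ∃ (ps : List Pos) (xs : List V) (vs : List (Term F V)),
    ps.Nodup ∧ xs.Nodup ∧ xs.length = ps.length ∧
    (∀ p : Pos, p ∈ ps ↔ p ∈ PosXVal M (∅ : Set V) ρ.lhs) ∧
    List.Forall₂ (fun p v => SubtermAt ρ.lhs p v ∧ M.IsValueTerm v) ps vs ∧
    (∀ x ∈ xs, x ∉ ρ.vars) ∧
    ρh.Z = ρ.Z ∪ {x | x ∈ xs} ∧
    ReplaceList ρ.lhs ps (xs.map Term.var) ρh.lhs ∧
    ρh.rhs = ρ.rhs ∧
    ρh.constr = M.conjFrom ρ.constr (List.zipWith M.eqc (xs.map Term.var) vs)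

/-- A most general rewrite step with a fresh variant of some rule of the LCTRS `R`. -/
def StepR (M : Model F V D) (R : Set (Rule F V)) (T T' : ECTerm F V) : Prop :=
  ∃ ρ ∈ R, ∃ ρ' : Rule F V, ρ'.IsVariantOf ρ ∧
    Disjoint ρ'.vars (T.term.vars ∪ T.ec.constr.vars) ∧ MGStep M ρ' T T'

/-- One `∼ · →_R` step (on well-formed, satisfiable existentially constrained terms). -/
def SimStep (M : Model F V D) (R : Set (Rule F V)) (T T' : ECTerm F V) : Prop :=
  ∃ U : ECTerm F V, U.WF ∧ U.satisfiable M ∧ ECEquiv M T U ∧ StepR M R U T'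

/-- `n`-fold composition of a relation. -/
def RelPow {α : Type _} (r : α → α → Prop) : ℕ → α → α → Prop
  | 0 => fun a b => a = b
  | n + 1 => fun a c => ∃ b, r a b ∧ RelPow r n b c


theorem Term.structural_induction {P : Term F V → Prop} (hvar : ∀ x, P (.var x))
    (happ : ∀ f ts, (∀ t ∈ ts, P t) → P (.app f ts)) : ∀ t, P t
  | .var x => hvar x
  | .app f ts => happ f ts fun t _ => Term.structural_induction hvar happ t
decreasing_by
  have := List.sizeOf_lt_of_mem ‹t ∈ ts›
  simp only [Term.app.sizeOf_spec] at *
  omega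

theorem Term.subst_var (x : V) (σ : V → Term F V) : (Term.var x).subst σ = σ x := by
  simp [Term.subst]

theorem Term.subst_app (f : F) (ts : List (Term F V)) (σ : V → Term F V) :
    (Term.app f ts).subst σ = .app f (ts.map (·.subst σ)) := by
  simp [Term.subst]

theorem Model.eval_var (M : Model F V D) (ξ : V → D) (x : V) : M.eval ξ (.var x) = ξ x := by
  simp [Model.eval]

theorem Model.eval_app (M : Model F V D) (ξ : V → D) (f : F) (ts : List (Term F V)) :
    M.eval ξ (.app f ts) = M.interp f (ts.map (M.eval ξ)) := by
  simp [Model.eval]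

theorem Term.mem_vars_var {x y : V} : x ∈ (Term.var y : Term F V).vars ↔ x = y := by
  constructor
  · rintro ⟨⟩; rfl
  · rintro rfl; exact .var

theorem Term.mem_vars_app {x : V} {f : F} {ts : List (Term F V)} :
    x ∈ (Term.app f ts).vars ↔ ∃ t ∈ ts, x ∈ t.vars := by
  constructor
  · intro h
    cases h with
    | app ht hx => exact ⟨_, ht, hx⟩
  · rintro ⟨t, ht, hx⟩
    exact .app ht hx

theorem Term.subst_congr {t : Term F V} {σ τ : V → Term F V} (h : ∀ x ∈ t.vars, σ x = τ x) :
    t.subst σ = t.subst τ := by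
  induction t using Term.structural_induction with
  | hvar x => simpa [Term.subst_var] using h x (Term.mem_vars_var.2 rfl)
  | happ f ts ih =>
    simp only [Term.subst_app, Term.app.injEq, true_and]
    exact List.map_congr_left fun t ht =>
      ih t ht fun x hx => h x (Term.mem_vars_app.2 ⟨t, ht, hx⟩)

theorem Term.subst_subst (t : Term F V) (σ τ : V → Term F V) :
    (t.subst σ).subst τ = t.subst fun x => (σ x).subst τ := by
  induction t using Term.structural_induction with
  | hvar x => simp [Term.subst_var]
  | happ f ts ih =>
    simpa [Term.subst_app] using ih

theorem Term.subst_id (t : Term F V) : t.subst Term.var = t := by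
  induction t using Term.structural_induction with
  | hvar x => simp [Term.subst_var]
  | happ f ts ih =>
    simp only [Term.subst_app, Term.app.injEq, true_and]
    exact (List.map_congr_left ih).trans (List.map_id' ts)

theorem Term.mem_vars_subst {t : Term F V} {σ : V → Term F V} {x : V} :
    x ∈ (t.subst σ).vars ↔ ∃ y ∈ t.vars, x ∈ (σ y).vars := by
  induction t using Term.structural_induction with
  | hvar z => simp [Term.subst_var, Term.mem_vars_var]
  | happ f ts ih =>
    simp only [Term.subst_app, Term.mem_vars_app, List.mem_map]
    constructor
    · rintro ⟨_, ⟨t, ht, rfl⟩, hx⟩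
      obtain ⟨y, hy, hxy⟩ := (ih t ht).1 hx
      exact ⟨y, ⟨t, ht, hy⟩, hxy⟩
    · rintro ⟨y, ⟨t, ht, hy⟩, hxy⟩
      exact ⟨_, ⟨t, ht, rfl⟩, (ih t ht).2 ⟨y, hy, hxy⟩⟩

theorem Term.eq_of_subst_eq_subst {t : Term F V} {σ τ : V → Term F V}
    (h : t.subst σ = t.subst τ) : ∀ x ∈ t.vars, σ x = τ x := by
  induction t using Term.structural_induction with
  | hvar z =>
    intro x hx
    obtain rfl := Term.mem_vars_var.1 hx
    simpa [Term.subst_var] using h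
  | happ f ts ih =>
    intro x hx
    obtain ⟨t, ht, hx⟩ := Term.mem_vars_app.1 hx
    simp only [Term.subst_app, Term.app.injEq, true_and] at h
    exact ih t ht (List.map_inj_left.1 h t ht) x hx

/-- Renaming of variables along a function. -/
def Term.rename (t : Term F V) (δ : V → V) : Term F V := t.subst fun x => .var (δ x)

theorem Term.rename_var (x : V) (δ : V → V) :
    (Term.var x : Term F V).rename δ = .var (δ x) := Term.subst_var _ _

theorem Term.rename_app (f : F) (ts : List (Term F V)) (δ : V → V) :
    (Term.app f ts).rename δ = .app f (ts.map (·.rename δ)) := Term.subst_app _ _ _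

theorem Term.mem_vars_rename {t : Term F V} {δ : V → V} {x : V} :
    x ∈ (t.rename δ).vars ↔ ∃ y ∈ t.vars, x = δ y := by
  simp [Term.rename, Term.mem_vars_subst, Term.mem_vars_var]

theorem Term.rename_mem_vars {t : Term F V} {δ : V → V} {x : V} (h : x ∈ t.vars) :
    δ x ∈ (t.rename δ).vars := Term.mem_vars_rename.2 ⟨x, h, rfl⟩

theorem Term.subst_rename (t : Term F V) (δ : V → V) (σ : V → Term F V) :
    (t.rename δ).subst σ = t.subst fun x => σ (δ x) := by
  simp [Term.rename, Term.subst_subst, Term.subst_var]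

theorem Term.rename_rename_of_inverse {t : Term F V} {δ ε : V → V}
    (h : ∀ x ∈ t.vars, ε (δ x) = x) : (t.rename δ).rename ε = t := by
  unfold Term.rename
  rw [Term.subst_subst]
  conv_rhs => rw [← t.subst_id]
  exact Term.subst_congr fun x hx => by simp [Term.subst_var, h x hx]

theorem Model.eval_subst (M : Model F V D) (ξ : V → D) (t : Term F V) (σ : V → Term F V) :
    M.eval ξ (t.subst σ) = M.eval (fun x => M.eval ξ (σ x)) t := by
  induction t using Term.structural_induction with
  | hvar x => simp [Term.subst_var, Model.eval_var]
  | happ f ts ih =>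
    simp only [Term.subst_app, Model.eval_app, List.map_map]
    exact congrArg _ (List.map_congr_left ih)

theorem Model.eval_rename (M : Model F V D) (ξ : V → D) (t : Term F V) (δ : V → V) :
    M.eval ξ (t.rename δ) = M.eval (ξ ∘ δ) t := by
  simp only [Term.rename, Model.eval_subst, Model.eval_var]
  rfl

theorem Model.eval_congr (M : Model F V D) {ξ η : V → D} {t : Term F V}
    (h : ∀ x ∈ t.vars, ξ x = η x) : M.eval ξ t = M.eval η t := by
  induction t using Term.structural_induction with
  | hvar x => simpa [Model.eval_var] using h x (Term.mem_vars_var.2 rfl)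
  | happ f ts ih =>
    simp only [Model.eval_app]
    exact congrArg _ (List.map_congr_left fun t ht =>
      ih t ht fun x hx => h x (Term.mem_vars_app.2 ⟨t, ht, hx⟩))

theorem Model.holds_conj (M : Model F V D) (ξ : V → D) (φ ψ : Term F V) :
    M.holds ξ (M.conj φ ψ) ↔ M.holds ξ φ ∧ M.holds ξ ψ := by
  simp [Model.holds, Model.conj, Model.eval_app, M.and_spec]

theorem Model.mem_vars_conj (M : Model F V D) {φ ψ : Term F V} {x : V} :
    x ∈ (M.conj φ ψ).vars ↔ x ∈ φ.vars ∨ x ∈ ψ.vars := by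
  simp [Model.conj, Term.mem_vars_app]

/-- A value term denoting a given element of the domain. -/
def Model.valueOf (M : Model F V D) (d : D) : Term F V := .app (M.val_surj d).choose []

theorem Model.isValueTerm_valueOf (M : Model F V D) (d : D) : M.IsValueTerm (M.valueOf d) :=
  ⟨_, (M.val_surj d).choose_spec.1, rfl⟩

theorem Model.eval_valueOf (M : Model F V D) (ξ : V → D) (d : D) :
    M.eval ξ (M.valueOf d) = d := by
  simpa [Model.valueOf, Model.eval_app] using (M.val_surj d).choose_spec.2

theorem Model.IsValueTerm.not_var {M : Model F V D} {x : V} : ¬ M.IsValueTerm (.var x) := by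
  rintro ⟨v, -, h⟩
  cases h

theorem Model.IsValueTerm.notMem_vars {M : Model F V D} {t : Term F V} (h : M.IsValueTerm t)
    (x : V) : x ∉ t.vars := by
  obtain ⟨v, -, rfl⟩ := h
  simp [Term.mem_vars_app]

theorem Model.IsValueTerm.eval_eq {M : Model F V D} {t : Term F V} (h : M.IsValueTerm t)
    (ξ η : V → D) : M.eval ξ t = M.eval η t :=
  M.eval_congr fun x hx => absurd hx (h.notMem_vars x)

theorem Model.IsValueTerm.rename {M : Model F V D} {t : Term F V} (h : M.IsValueTerm t)
    (δ : V → V) : M.IsValueTerm (t.rename δ) := by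
  obtain ⟨v, hv, rfl⟩ := h
  exact ⟨v, hv, by simp [Term.rename_app]⟩

/-- The denotation of a substitution on variables that it maps to values. -/
def Model.denote (M : Model F V D) (σ : V → Term F V) (x : V) : D :=
  M.eval (fun _ => M.tval) (σ x)

/-- The substitution instantiating the variables of `X` with values according to `ξ`. -/
def Model.instantiate (M : Model F V D) (X : Set V) (ξ : V → D) (x : V) : Term F V :=
  if x ∈ X then M.valueOf (ξ x) else .var x

theorem EC.holdsUnder_iff_exists_forall_notMem {c : EC F V} {M : Model F V D} {ξ : V → D} :
    c.holdsUnder M ξ ↔ ∃ η : V → D, (∀ x ∉ c.bvars, η x = ξ x) ∧ M.holds η c.constr := by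
  constructor
  · rintro ⟨κ, -, hκ, h⟩
    refine ⟨fun x => M.eval ξ (κ x), fun x hx => by simp [hκ x hx, Model.eval_var], ?_⟩
    rwa [Model.holds, Model.eval_subst] at h
  · rintro ⟨η, hη, h⟩
    refine ⟨M.instantiate c.bvars η, fun x hx => ?_, fun x hx => ?_, ?_⟩
    · simpa [Model.instantiate, hx] using M.isValueTerm_valueOf _
    · simp [Model.instantiate, hx]
    · rw [Model.holds, Model.eval_subst, ← h]
      refine M.eval_congr fun x _ => ?_
      by_cases hx : x ∈ c.bvars
      · simp [Model.instantiate, hx, Model.eval_valueOf]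
      · simp [Model.instantiate, hx, Model.eval_var, hη x hx]

theorem EC.holdsUnder_iff {c : EC F V} {M : Model F V D} {ξ : V → D} :
    c.holdsUnder M ξ ↔ ∃ η : V → D, (∀ x ∈ c.fvars, η x = ξ x) ∧ M.holds η c.constr := by
  rw [EC.holdsUnder_iff_exists_forall_notMem]
  constructor
  · rintro ⟨η, hη, h⟩
    exact ⟨η, fun x hx => hη x hx.2, h⟩
  · rintro ⟨η, hη, h⟩
    refine ⟨fun x => if x ∈ c.bvars then η x else ξ x, fun x hx => by simp [hx], ?_⟩
    rw [Model.holds, ← h]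
    refine M.eval_congr fun x hx => ?_
    by_cases hb : x ∈ c.bvars
    · simp [hb]
    · simp [hb, hη x ⟨hx, hb⟩]

theorem EC.holdsUnder_congr {c : EC F V} {M : Model F V D} {ξ η : V → D}
    (h : ∀ x ∈ c.fvars, ξ x = η x) (hξ : c.holdsUnder M ξ) : c.holdsUnder M η := by
  rw [EC.holdsUnder_iff] at hξ ⊢
  obtain ⟨ζ, hζ, hc⟩ := hξ
  exact ⟨ζ, fun x hx => (hζ x hx).trans (h x hx), hc⟩

theorem SubstRespectsEC_iff {M : Model F V D} {σ : V → Term F V} {c : EC F V} :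
    SubstRespectsEC M σ c ↔
      (∀ x ∈ c.fvars, M.IsValueTerm (σ x)) ∧ c.holdsUnder M (M.denote σ) := by
  refine and_congr_right fun hσ => ?_
  have key (η : V → D) : M.holds η (c.subst σ).constr ↔
      M.holds (fun x => if x ∈ c.bvars then η x else M.denote σ x) c.constr := by
    rw [Model.holds, Model.holds, EC.subst, Model.eval_subst]
    refine Eq.congr_left (M.eval_congr fun x hx => ?_)
    by_cases hb : x ∈ c.bvars
    · simp [hb, Model.eval_var]
    · simpa [hb, Model.denote] using (hσ x ⟨hx, hb⟩).eval_eq _ _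
  constructor
  · intro h
    obtain ⟨η, -, hη⟩ := EC.holdsUnder_iff_exists_forall_notMem.1 (h fun _ => M.tval)
    exact EC.holdsUnder_iff_exists_forall_notMem.2
      ⟨_, fun x hx => by simp [hx], (key η).1 hη⟩
  · intro h ξ
    obtain ⟨η, hη, hc⟩ := EC.holdsUnder_iff_exists_forall_notMem.1 h
    refine EC.holdsUnder_iff_exists_forall_notMem.2
      ⟨fun x => if x ∈ c.bvars then η x else ξ x, fun x hx => if_neg hx, (key _).2 ?_⟩
    rw [Model.holds, ← hc]
    refine M.eval_congr fun x _ => ?_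
    by_cases hb : x ∈ c.bvars
    · simp [hb]
    · simp [hb, hη x hb]

theorem SubtermAt.vars_subset {s u : Term F V} {p : Pos} (h : SubtermAt s p u) :
    u.vars ⊆ s.vars := by
  induction h with
  | refl => exact subset_rfl
  | app hi _ ih => exact fun x hx => Term.mem_vars_app.2 ⟨_, List.mem_of_getElem? hi, ih hx⟩

theorem SubtermAt.rename {s u : Term F V} {p : Pos} (h : SubtermAt s p u) (δ : V → V) :
    SubtermAt (s.rename δ) p (u.rename δ) := by
  induction h with
  | refl => exact .refl _
  | app hi _ ih =>
    rw [Term.rename_app]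
    exact .app (by simp [hi]) ih

theorem ReplaceAt.rename {s u t : Term F V} {p : Pos} (h : ReplaceAt s p u t) (δ : V → V) :
    ReplaceAt (s.rename δ) p (u.rename δ) (t.rename δ) := by
  induction h with
  | here => exact .here _ _
  | app hi _ ih =>
    simp only [Term.rename_app, List.map_set]
    exact .app (by simp [hi]) ih

theorem ReplaceAt.vars_subset {s u t : Term F V} {p : Pos} (h : ReplaceAt s p u t) :
    t.vars ⊆ s.vars ∪ u.vars := by
  induction h with
  | here => exact Set.subset_union_right
  | app hi _ ih =>
    intro x hx
    obtain ⟨w, hw, hxw⟩ := Term.mem_vars_app.1 hx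
    rcases List.mem_or_eq_of_mem_set hw with hw | rfl
    · exact .inl (Term.mem_vars_app.2 ⟨w, hw, hxw⟩)
    · exact (ih hxw).imp_left fun h => Term.mem_vars_app.2 ⟨_, List.mem_of_getElem? hi, h⟩

theorem ReplaceAt.vars_replacement_subset {s u t : Term F V} {p : Pos}
    (h : ReplaceAt s p u t) : u.vars ⊆ t.vars := by
  induction h with
  | here => exact subset_rfl
  | @app f ts i p u t t' hi _ ih =>
    intro x hx
    have hlt : i < ts.length := (List.getElem?_eq_some_iff.1 hi).1
    exact Term.mem_vars_app.2 ⟨t', List.mem_set hlt t', ih hx⟩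

theorem SubtermAt.exists_var_of_mem_vars {t : Term F V} {x : V} (h : x ∈ t.vars) :
    ∃ p, SubtermAt t p (.var x) := by
  change Term.VarIn x t at h
  induction h with
  | var => exact ⟨[], .refl _⟩
  | app ht _ ih =>
    obtain ⟨p, hp⟩ := ih
    obtain ⟨i, hi⟩ := List.mem_iff_getElem?.1 ht
    exact ⟨i :: p, .app hi hp⟩

theorem SubtermAt.subst_eq_subst {s t u w : Term F V} {p : Pos} {σ τ : V → Term F V}
    (hs : SubtermAt s p u) (ht : SubtermAt t p w) (h : s.subst σ = t.subst τ) :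
    u.subst σ = w.subst τ := by
  induction hs generalizing t with
  | refl => cases ht; exact h
  | @app f ts i a u p hi _ ih =>
    cases ht with
    | @app g us _ b _ _ hj hw =>
      simp only [Term.subst_app, Term.app.injEq] at h
      refine ih hw ?_
      have := congrArg (·[i]?) h.2
      simpa [hi, hj] using this

theorem Term.ValueFree.of_mem {M : Model F V D} {f : F} {ts : List (Term F V)} {t : Term F V}
    (h : (Term.app f ts).ValueFree M) (ht : t ∈ ts) : t.ValueFree M := by
  intro p u hu
  obtain ⟨i, hi⟩ := List.mem_iff_getElem?.1 ht
  exact h (i :: p) u (.app hi hu)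

theorem Term.ValueFree.notMem_val {M : Model F V D} {f : F} {ts : List (Term F V)}
    (h : (Term.app f ts).ValueFree M) : f ∉ M.Val :=
  fun hf => h [] _ (.refl _) ⟨f, hf, ts, rfl⟩

theorem Model.instantiate_ne_app_subst {M : Model F V D} {X : Set V} {ξ : V → D} {x : V}
    {f : F} {ts us : List (Term F V)} (h : (Term.app f ts).ValueFree M) :
    M.instantiate X ξ x ≠ .app f us := by
  unfold Model.instantiate
  split_ifs
  · intro he
    obtain ⟨v, hv, hve⟩ := M.isValueTerm_valueOf (ξ x)
    rw [hve, Term.app.injEq] at he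
    exact h.notMem_val (he.1 ▸ hv)
  · simp

/-- Value-free terms that are instances of each other via instantiations by values differ by a
renaming of variables. -/
theorem Term.eq_rename_of_subst_eq {M : Model F V D} {X Y : Set V} {ξ η : V → D}
    {γ τ : V → Term F V} {δ : V → V} {s t : Term F V}
    (hs : s.ValueFree M) (ht : t.ValueFree M)
    (hst : s.subst (M.instantiate X ξ) = t.subst γ)
    (hts : t.subst (M.instantiate Y η) = s.subst τ)
    (hδ : ∀ p x y, SubtermAt s p (.var x) → SubtermAt t p (.var y) → δ x = y) :
    t = s.rename δ := by
  induction s using Term.structural_induction generalizing t with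
  | hvar x =>
    cases t with
    | var y => rw [Term.rename_var, hδ [] x y (.refl _) (.refl _)]
    | app g us =>
      rw [Term.subst_var, Term.subst_app] at hst
      exact absurd hst (Model.instantiate_ne_app_subst ht)
  | happ f ts ih =>
    cases t with
    | var y =>
      rw [Term.subst_var, Term.subst_app] at hts
      exact absurd hts (Model.instantiate_ne_app_subst hs)
    | app g us =>
      simp only [Term.subst_app, Term.app.injEq] at hst hts
      rw [Term.rename_app, hst.1, Term.app.injEq]
      refine ⟨rfl, ?_⟩
      have hlen : us.length = ts.length := by simpa using congrArg List.length hts.2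
      refine List.ext_getElem (by simpa using hlen) fun i hi hi' => ?_
      have hi'' : i < ts.length := hlen ▸ hi
      rw [List.getElem_map]
      refine ih _ (List.getElem_mem hi'') (hs.of_mem (List.getElem_mem _))
        (ht.of_mem (List.getElem_mem _)) ?_ ?_ fun p x y hx hy => ?_
      · have := congrArg (·[i]?) hst.2
        simpa [hi, hi''] using this
      · have := congrArg (·[i]?) hts.2
        simpa [hi, hi''] using this
      · exact hδ (i :: p) x y (.app (by simp [hi'']) hx) (.app (by simp [hi]) hy)

theorem SubtermAt.unique {s u w : Term F V} {p : Pos} (hu : SubtermAt s p u)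
    (hw : SubtermAt s p w) : u = w := by
  have := hu.subst_eq_subst hw (σ := Term.var) (τ := Term.var) rfl
  rwa [Term.subst_id, Term.subst_id] at this

/-- The variable of `t` at a position where `s` has the variable `x`, if there is one. -/
def Term.varMatch (s t : Term F V) (x : V) : V :=
  if h : ∃ y p, SubtermAt s p (.var x) ∧ SubtermAt t p (.var y) then h.choose else x

theorem Term.varMatch_eq {s t : Term F V} {x y : V} {p : Pos}
    (huniq : ∀ p q x y z, SubtermAt s p (.var x) → SubtermAt t p (.var y) →
      SubtermAt s q (.var x) → SubtermAt t q (.var z) → y = z)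
    (hx : SubtermAt s p (.var x)) (hy : SubtermAt t p (.var y)) : s.varMatch t x = y := by
  have h : ∃ y p, SubtermAt s p (.var x) ∧ SubtermAt t p (.var y) := ⟨y, p, hx, hy⟩
  rw [Term.varMatch, dif_pos h]
  obtain ⟨q, hq, hq'⟩ := h.choose_spec
  exact huniq q p x _ y hq hq' hx hy

theorem Term.varMatch_of_notMem {s t : Term F V} {x : V} (hx : x ∉ s.vars) :
    s.varMatch t x = x := by
  refine dif_neg ?_
  rintro ⟨y, p, hp, -⟩
  exact hx (hp.vars_subset (Term.mem_vars_var.2 rfl))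

theorem Model.instantiate_of_notMem {M : Model F V D} {X : Set V} {ξ : V → D} {x : V}
    (h : x ∉ X) : M.instantiate X ξ x = .var x := if_neg h

theorem Model.isValueTerm_instantiate {M : Model F V D} {X : Set V} {ξ : V → D} {x : V}
    (h : x ∈ X) : M.IsValueTerm (M.instantiate X ξ x) := by
  simpa [Model.instantiate, h] using M.isValueTerm_valueOf _

theorem Model.denote_instantiate {M : Model F V D} {X : Set V} {ξ : V → D} {x : V}
    (h : x ∈ X) : M.denote (M.instantiate X ξ) x = ξ x := by
  simp [Model.denote, Model.instantiate, h, Model.eval_valueOf]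

theorem SubsumedBy.exists_subst_instantiate {M : Model F V D} {T S : ECTerm F V}
    (h : SubsumedBy M T S) (hT : T.WF) {ξ : V → D} (hξ : T.ec.holdsUnder M ξ) :
    ∃ γ : V → Term F V, (∀ y ∈ S.lvars, M.IsValueTerm (γ y)) ∧ SubstRespectsEC M γ S.ec ∧
      T.term.subst (M.instantiate T.lvars ξ) = S.term.subst γ :=
  h _ (fun _ hx => Model.isValueTerm_instantiate hx) <| SubstRespectsEC_iff.2
    ⟨fun _ hx => Model.isValueTerm_instantiate (hT.2.1 hx),
      EC.holdsUnder_congr (fun _ hx => (Model.denote_instantiate (hT.2.1 hx)).symm) hξ⟩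

/-- `δ` renames the variables of `T` to those of `S` with inverse `ε`, and the constraint of `T`
implies the correspondingly renamed constraint of `S`. -/
structure ECTerm.Renames (M : Model F V D) (T S : ECTerm F V) (δ ε : V → V) : Prop where
  term_eq : S.term = T.term.rename δ
  left_inv : ∀ x ∈ T.term.vars, ε (δ x) = x
  fix : ∀ x ∉ T.term.vars, δ x = x
  mem_lvars_iff : ∀ x ∈ T.term.vars, (δ x ∈ S.lvars ↔ x ∈ T.lvars)
  ec : ∀ ξ, T.ec.holdsUnder M ξ → S.ec.holdsUnder M (ξ ∘ ε)

theorem mem_lvars_of_subst_instantiate_eq {M : Model F V D} {X Y : Set V} {ξ : V → D}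
    {s t : Term F V} {γ : V → Term F V} {p : Pos} {x y : V}
    (hγ : ∀ y ∈ Y, M.IsValueTerm (γ y)) (h : s.subst (M.instantiate X ξ) = t.subst γ)
    (hx : SubtermAt s p (.var x)) (hy : SubtermAt t p (.var y)) (hyY : y ∈ Y) : x ∈ X := by
  by_contra hxX
  have := hx.subst_eq_subst hy h
  rw [Term.subst_var, Term.subst_var, Model.instantiate_of_notMem hxX] at this
  exact Model.IsValueTerm.not_var (this ▸ hγ y hyY)

theorem var_unique_of_subst_instantiate_eq {M : Model F V D} {X Y : Set V} {ξ η : V → D}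
    {s t : Term F V} {γ τ : V → Term F V} {p q : Pos} {x y z : V}
    (hlin : s.LinearOn X) (hγ : ∀ y ∈ Y, M.IsValueTerm (γ y))
    (hst : s.subst (M.instantiate X ξ) = t.subst γ)
    (hts : t.subst (M.instantiate Y η) = s.subst τ)
    (hxp : SubtermAt s p (.var x)) (hyp : SubtermAt t p (.var y))
    (hxq : SubtermAt s q (.var x)) (hzq : SubtermAt t q (.var z)) : y = z := by
  by_cases hx : x ∈ X
  · obtain rfl := hlin x hx p q hxp hxq
    simpa using hyp.unique hzq
  · have key {r : Pos} {w : V} (hxr : SubtermAt s r (.var x)) (hwr : SubtermAt t r (.var w)) :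
        Term.var w = τ x := by
      have := hwr.subst_eq_subst hxr hts
      rwa [Term.subst_var, Term.subst_var, Model.instantiate_of_notMem fun hw =>
        hx (mem_lvars_of_subst_instantiate_eq hγ hst hxr hwr hw)] at this
    simpa using (key hxp hyp).trans (key hxq hzq).symm

theorem SubsumedBy.renames {M : Model F V D} {T S : ECTerm F V} {δ ε : V → V}
    (h : SubsumedBy M T S) (hT : T.WF) (hS : S.WF)
    (hterm : S.term = T.term.rename δ) (hinv : ∀ x ∈ T.term.vars, ε (δ x) = x)
    (hfix : ∀ x ∉ T.term.vars, δ x = x)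
    (hlv : ∀ x ∈ T.term.vars, (δ x ∈ S.lvars ↔ x ∈ T.lvars)) : T.Renames M S δ ε where
  term_eq := hterm
  left_inv := hinv
  fix := hfix
  mem_lvars_iff := hlv
  ec ξ hξ := by
    obtain ⟨γ, -, hγ, heq⟩ := h.exists_subst_instantiate hT hξ
    rw [hterm, Term.subst_rename] at heq
    refine EC.holdsUnder_congr (fun y hy => ?_) (SubstRespectsEC_iff.1 hγ).2
    have hyS := hS.2.1 hy
    obtain ⟨x, hx, rfl⟩ := Term.mem_vars_rename.1 (hterm ▸ hS.2.2.1 hyS)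
    rw [Model.denote, ← Term.eq_of_subst_eq_subst heq x hx, Function.comp_apply, hinv x hx]
    exact Model.denote_instantiate ((hlv x hx).1 hyS)

/-- Equivalent satisfiable pattern-general terms differ by a renaming of variables. -/
theorem ECEquiv.exists_renames {M : Model F V D} {T S : ECTerm F V} (h : ECEquiv M T S)
    (hT : T.WF) (hS : S.WF) (hTsat : T.satisfiable M) (hSsat : S.satisfiable M)
    (hTpg : T.PatternGeneral M) (hSpg : S.PatternGeneral M) :
    ∃ δ ε, T.Renames M S δ ε ∧ S.Renames M T ε δ := by
  obtain ⟨ξ, hξ⟩ := hTsat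
  obtain ⟨η, hη⟩ := hSsat
  obtain ⟨γ, hγ, -, hst⟩ := h.1.exists_subst_instantiate hT hξ
  obtain ⟨τ, hτ, -, hts⟩ := h.2.exists_subst_instantiate hS hη
  set δ := T.term.varMatch S.term with hδ
  set ε := S.term.varMatch T.term with hε
  have hδ_eq {p x y} (hx : SubtermAt T.term p (.var x)) (hy : SubtermAt S.term p (.var y)) :
      δ x = y :=
    Term.varMatch_eq (fun _ _ _ _ _ =>
      var_unique_of_subst_instantiate_eq hTpg.1 hγ hst hts) hx hy
  have hε_eq {p x y} (hx : SubtermAt S.term p (.var x)) (hy : SubtermAt T.term p (.var y)) :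
      ε x = y :=
    Term.varMatch_eq (fun _ _ _ _ _ =>
      var_unique_of_subst_instantiate_eq hSpg.1 hτ hts hst) hx hy
  have hδ_term : S.term = T.term.rename δ :=
    Term.eq_rename_of_subst_eq hTpg.2 hSpg.2 hst hts fun _ _ _ => hδ_eq
  have hε_term : T.term = S.term.rename ε :=
    Term.eq_rename_of_subst_eq hSpg.2 hTpg.2 hts hst fun _ _ _ => hε_eq
  have hδ_at {p x} (hx : SubtermAt T.term p (.var x)) : SubtermAt S.term p (.var (δ x)) := by
    rw [hδ_term, ← Term.rename_var]
    exact hx.rename δ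
  have hε_at {p x} (hx : SubtermAt S.term p (.var x)) : SubtermAt T.term p (.var (ε x)) := by
    rw [hε_term, ← Term.rename_var]
    exact hx.rename ε
  refine ⟨δ, ε, h.1.renames hT hS hδ_term (fun x hx => ?_)
    (fun _ => Term.varMatch_of_notMem) fun x hx => ?_,
    h.2.renames hS hT hε_term (fun x hx => ?_)
    (fun _ => Term.varMatch_of_notMem) fun x hx => ?_⟩
  · obtain ⟨p, hp⟩ := SubtermAt.exists_var_of_mem_vars hx
    exact hε_eq (hδ_at hp) hp
  · obtain ⟨p, hp⟩ := SubtermAt.exists_var_of_mem_vars hx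
    exact ⟨mem_lvars_of_subst_instantiate_eq hγ hst hp (hδ_at hp),
      mem_lvars_of_subst_instantiate_eq hτ hts (hδ_at hp) hp⟩
  · obtain ⟨p, hp⟩ := SubtermAt.exists_var_of_mem_vars hx
    exact hδ_eq (hε_at hp) hp
  · obtain ⟨p, hp⟩ := SubtermAt.exists_var_of_mem_vars hx
    exact ⟨mem_lvars_of_subst_instantiate_eq hτ hts hp (hε_at hp),
      mem_lvars_of_subst_instantiate_eq hγ hst (hε_at hp) hp⟩

section Step

variable {M : Model F V D} {ρ : Rule F V} {T T' S S' : ECTerm F V} {p : Pos}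
  {γ τ : V → Term F V} {δ ε : V → V}

theorem Rule.exVars_subset_vars : ρ.exVars ⊆ ρ.vars := fun _ hx => .inl (.inr hx.1)

theorem RedexAt.apply_of_notMem (h : RedexAt M ρ T p γ) {x : V} (hx : x ∉ ρ.lhs.vars) :
    γ x = .var x := by
  rw [← h.dom] at hx
  simpa [substDom] using hx

theorem RedexAt.vars_apply_subset (h : RedexAt M ρ T p γ) {x : V} (hx : x ∈ ρ.lhs.vars) :
    (γ x).vars ⊆ T.term.vars :=
  fun _ hz => h.matchAt.vars_subset (Term.mem_vars_subst.2 ⟨x, hx, hz⟩)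

theorem RedexAt.vars_constr_subset (h : RedexAt M ρ T p γ) (hρ : ρ.WF) :
    (ρ.constr.subst γ).vars ⊆ T.lvars ∪ (ρ.constr.vars \ ρ.lhs.vars) := by
  intro z hz
  obtain ⟨x, hx, hz⟩ := Term.mem_vars_subst.1 hz
  by_cases hl : x ∈ ρ.lhs.vars
  · rcases h.lvar x ⟨hl, hρ.1 (.inr hx)⟩ with hv | ⟨y, hy, hxy⟩
    · exact absurd hz (hv.notMem_vars z)
    · rw [hxy, Term.mem_vars_var] at hz
      exact .inl (hz ▸ hy)
  · rw [h.apply_of_notMem hl, Term.mem_vars_var] at hz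
    exact .inr (hz ▸ ⟨hx, hl⟩)

theorem MGStepData.vars_term_subset (h : MGStepData M ρ T T' p γ) :
    T'.term.vars ⊆ T.term.vars ∪ ρ.exVars := by
  intro z hz
  refine (h.target.vars_subset hz).elim .inl fun hz => ?_
  obtain ⟨x, hx, hz⟩ := Term.mem_vars_subst.1 hz
  by_cases hl : x ∈ ρ.lhs.vars
  · exact .inl (h.redex.vars_apply_subset hl hz)
  · rw [h.redex.apply_of_notMem hl, Term.mem_vars_var] at hz
    exact .inr (hz ▸ ⟨hx, hl⟩)

theorem MGStepData.exVars_subset (h : MGStepData M ρ T T' p γ) : ρ.exVars ⊆ T'.term.vars :=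
  fun x hx => h.target.vars_replacement_subset <| Term.mem_vars_subst.2
    ⟨x, hx.1, by rw [h.redex.apply_of_notMem hx.2, Term.mem_vars_var]⟩

theorem MGStepData.notMem_bvars (h : MGStepData M ρ T T' p γ) (hT : T.WF)
    (hdT : Disjoint ρ.vars (T.term.vars ∪ T.ec.constr.vars)) {z : V} (hz : z ∈ T'.term.vars) :
    z ∉ T.ec.bvars := fun hb =>
  (h.vars_term_subset hz).elim (hT.2.2.2 z hb) fun hz =>
    Set.disjoint_left.1 hdT (Rule.exVars_subset_vars hz) (.inr (hT.1 hb))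

theorem MGStepData.wf (h : MGStepData M ρ T T' p γ) (hρ : ρ.WF) (hT : T.WF)
    (hdT : Disjoint ρ.vars (T.term.vars ∪ T.ec.constr.vars)) : T'.WF := by
  refine ⟨?_, ?_, ?_, ?_⟩
  · rw [EC.WF, h.bnd]
    exact Set.sdiff_subset
  · rintro z ⟨hz, hzb⟩
    have hzT : z ∈ T'.term.vars := by
      by_contra hn
      exact hzb (h.bnd ▸ ⟨hz, hn⟩)
    rw [h.lv]
    rw [h.cstr, Model.mem_vars_conj] at hz
    rcases hz with hz | hz
    · exact .inr ⟨hT.2.1 ⟨hz, h.notMem_bvars hT hdT hzT⟩, hzT⟩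
    · rcases h.redex.vars_constr_subset hρ hz with hz | hz
      · exact .inr ⟨hz, hzT⟩
      · exact .inl <| (h.vars_term_subset hzT).elim
          (fun hs => absurd (.inl hs) (Set.disjoint_left.1 hdT (.inr hz.1))) id
  · rw [h.lv]
    exact Set.union_subset h.exVars_subset Set.inter_subset_right
  · rw [h.bnd]
    exact fun _ hx => hx.2

theorem ECTerm.Renames.left_inv_of_mem (h : T.Renames M S δ ε) (h' : S.Renames M T ε δ)
    (hdT : Disjoint ρ.vars (T.term.vars ∪ T.ec.constr.vars))
    (hdS : Disjoint ρ.vars (S.term.vars ∪ S.ec.constr.vars)) {x : V}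
    (hx : x ∈ T.term.vars ∪ ρ.vars) : ε (δ x) = x := by
  rcases hx with hx | hx
  · exact h.left_inv x hx
  · rw [h.fix x fun hs => Set.disjoint_left.1 hdT hx (.inl hs),
      h'.fix x fun hs => Set.disjoint_left.1 hdS hx (.inl hs)]

theorem MGStepData.vars_constr_subst_subset (h : MGStepData M ρ T T' p γ) (hρ : ρ.WF)
    (hT : T.WF) : (ρ.constr.subst γ).vars ⊆ T.term.vars ∪ ρ.vars :=
  (h.redex.vars_constr_subset hρ).trans <| Set.union_subset_union hT.2.2.1 fun _ hx => .inr hx.1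

theorem MGStepData.subsumedBy (hρ : ρ.WF) (hT : T.WF) (hS : S.WF)
    (hdT : Disjoint ρ.vars (T.term.vars ∪ T.ec.constr.vars))
    (hdS : Disjoint ρ.vars (S.term.vars ∪ S.ec.constr.vars))
    (h : T.Renames M S δ ε) (h' : S.Renames M T ε δ)
    (hst : MGStepData M ρ T T' p γ) (hst' : MGStepData M ρ S S' p τ)
    (hterm : S'.term = T'.term.rename δ)
    (hconstr : ρ.constr.subst τ = (ρ.constr.subst γ).rename δ) : SubsumedBy M T' S' := by
  intro σ hσ hσT
  have hinv {x : V} (hx : x ∈ T.term.vars ∪ ρ.vars) : ε (δ x) = x :=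
    h.left_inv_of_mem h' hdT hdS hx
  have hmem {x : V} (hx : x ∈ T'.term.vars) : x ∈ T.term.vars ∪ ρ.vars :=
    Set.union_subset_union_right _ Rule.exVars_subset_vars (hst.vars_term_subset hx)
  have hval : ∀ y ∈ S'.lvars, M.IsValueTerm (σ (ε y)) := by
    intro y hy
    rw [hst'.lv] at hy
    refine hσ _ ?_
    rw [hst.lv]
    rcases hy with hy | ⟨hy, hyt⟩
    · rw [h'.fix y fun hs => Set.disjoint_left.1 hdS (Rule.exVars_subset_vars hy) (.inl hs)]
      exact .inl hy
    · rw [hterm] at hyt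
      obtain ⟨x, hx, rfl⟩ := Term.mem_vars_rename.1 hyt
      have hyS := hS.2.2.1 hy
      have := (h'.mem_lvars_iff _ hyS).2 hy
      rw [hinv (hmem hx)] at this ⊢
      exact .inr ⟨this, hx⟩
  refine ⟨fun y => σ (ε y), hval, ?_, ?_⟩
  · have hwf := hst'.wf hρ hS hdS
    refine SubstRespectsEC_iff.2 ⟨fun y hy => hval y (hwf.2.1 hy), ?_⟩
    obtain ⟨η, hη, hηc⟩ := EC.holdsUnder_iff_exists_forall_notMem.1 (SubstRespectsEC_iff.1 hσT).2
    rw [hst.cstr, Model.holds_conj] at hηc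
    obtain ⟨ζ, hζ, hζc⟩ := EC.holdsUnder_iff_exists_forall_notMem.1 <|
      h.ec η (EC.holdsUnder_iff.2 ⟨η, fun _ _ => rfl, hηc.1⟩)
    refine EC.holdsUnder_iff.2 ⟨ζ, fun y hy => ?_, ?_⟩
    · have hyt := hwf.2.2.1 (hwf.2.1 hy)
      rw [hζ y (hst'.notMem_bvars hS hdS hyt)]
      rw [hterm] at hyt
      obtain ⟨x, hx, rfl⟩ := Term.mem_vars_rename.1 hyt
      rw [Function.comp_apply, Model.denote, hinv (hmem hx)]
      refine hη x ?_
      rw [hst.bnd]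
      exact fun hb => hb.2 hx
    · rw [hst'.cstr, Model.holds_conj]
      refine ⟨hζc, ?_⟩
      rw [hconstr, Model.holds, Model.eval_rename, ← hηc.2]
      refine M.eval_congr fun x hx => ?_
      have hδx : δ x ∉ S.ec.bvars := by
        intro hb
        rcases hst'.vars_constr_subst_subset hρ hS (hconstr ▸ Term.rename_mem_vars hx) with hs | hr
        · exact hS.2.2.2 _ hb hs
        · exact Set.disjoint_left.1 hdS hr (.inr (hS.1 hb))
      rw [Function.comp_apply, hζ _ hδx, Function.comp_apply,
        hinv (hst.vars_constr_subst_subset hρ hT hx)]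
  · rw [hterm, Term.subst_rename]
    exact Term.subst_congr fun x hx => by rw [hinv (hmem hx)]

/-- The matching substitution of a redex transported along a renaming. -/
def Rule.renameMatch (ρ : Rule F V) (γ : V → Term F V) (δ : V → V) (x : V) : Term F V :=
  if x ∈ ρ.lhs.vars then (γ x).rename δ else .var x

theorem RedexAt.subst_renameMatch (hr : RedexAt M ρ T p γ) (h : T.Renames M S δ ε)
    (hdT : Disjoint ρ.vars (T.term.vars ∪ T.ec.constr.vars)) {u : Term F V}
    (hu : u.vars ⊆ ρ.vars) : u.subst (ρ.renameMatch γ δ) = (u.subst γ).rename δ := by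
  rw [Term.rename, Term.subst_subst]
  refine Term.subst_congr fun x hx => ?_
  by_cases hl : x ∈ ρ.lhs.vars
  · simp [Rule.renameMatch, hl, Term.rename]
  · rw [Rule.renameMatch, if_neg hl, hr.apply_of_notMem hl, Term.subst_var,
      h.fix x fun hs => Set.disjoint_left.1 hdT (hu hx) (.inl hs)]

theorem RedexAt.renames (hr : RedexAt M ρ T p γ) (hρ : ρ.WF) (hT : T.WF)
    (hdT : Disjoint ρ.vars (T.term.vars ∪ T.ec.constr.vars))
    (hdS : Disjoint ρ.vars (S.term.vars ∪ S.ec.constr.vars))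
    (h : T.Renames M S δ ε) (h' : S.Renames M T ε δ) :
    RedexAt M ρ S p (ρ.renameMatch γ δ) := by
  have hmatch : SubtermAt S.term p (ρ.lhs.subst (ρ.renameMatch γ δ)) := by
    rw [hr.subst_renameMatch h hdT fun _ hx => .inl (.inl hx), h.term_eq]
    exact hr.matchAt.rename δ
  refine ⟨?_, hmatch, fun x hx => ?_, fun ξ hξ => ?_⟩
  · ext x
    by_cases hl : x ∈ ρ.lhs.vars
    · refine iff_of_true (fun he => ?_) hl
      exact Set.disjoint_left.1 hdS (.inl (.inl hl)) <| .inl <| hmatch.vars_subset <|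
        Term.mem_vars_subst.2 ⟨x, hl, by rw [he, Term.mem_vars_var]⟩
    · simp [substDom, Rule.renameMatch, hl]
  · rw [Rule.renameMatch, if_pos hx.1]
    refine (hr.lvar x hx).imp (·.rename δ) ?_
    rintro ⟨y, hy, hxy⟩
    exact ⟨δ y, (h.mem_lvars_iff y (hT.2.2.1 hy)).2 hy, by rw [hxy, Term.rename_var]⟩
  · obtain ⟨η, hη, hc⟩ := EC.holdsUnder_iff_exists_forall_notMem.1 (hr.implied _ (h'.ec ξ hξ))
    refine EC.holdsUnder_iff_exists_forall_notMem.2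
      ⟨fun x => if x ∈ ρ.constr.vars \ ρ.lhs.vars then η x else ξ x, fun x hx => if_neg hx, ?_⟩
    change M.holds _ (ρ.constr.subst (ρ.renameMatch γ δ))
    rw [hr.subst_renameMatch h hdT fun _ hx => .inr hx, Model.holds, Model.eval_rename, ← hc]
    refine M.eval_congr fun x hx => ?_
    rw [Function.comp_apply]
    rcases hr.vars_constr_subset hρ hx with hx | hx
    · have hxT := hT.2.2.1 hx
      have hδx : δ x ∈ S.term.vars := h.term_eq ▸ Term.rename_mem_vars hxT
      rw [if_neg fun hb => Set.disjoint_left.1 hdS (.inr hb.1) (.inl hδx),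
        hη x fun hb => Set.disjoint_left.1 hdT (.inr hb.1) (.inl hxT), Function.comp_apply]
    · rw [h.fix x fun hs => Set.disjoint_left.1 hdT (.inr hx.1) (.inl hs), if_pos hx]

end Step

/-- **Commutation of Rewrite Steps and Equivalence for Pattern-General Terms.** -/
theorem commutation_pattern_general {F V D : Type} (M : Model F V D)
    (ρ : Rule F V) (T S T' : ECTerm F V)
    (hρ : ρ.WF) (hll : ρ.LeftLinear)
    (hT : T.WF) (hS : S.WF)
    (hTsat : T.satisfiable M) (hSsat : S.satisfiable M)
    (hTpg : T.PatternGeneral M) (hSpg : S.PatternGeneral M)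
    (hdT : Disjoint ρ.vars (T.term.vars ∪ T.ec.constr.vars))
    (hdS : Disjoint ρ.vars (S.term.vars ∪ S.ec.constr.vars))
    (hstep : MGStep M ρ T T') (hequiv : ECEquiv M T S) :
    ∃ S' : ECTerm F V, S'.WF ∧ ECEquiv M T' S' ∧ MGStep M ρ S S' := by
  obtain ⟨p, γ, hst⟩ := hstep
  obtain ⟨δ, ε, h, h'⟩ := hequiv.exists_renames hT hS hTsat hSsat hTpg hSpg
  have hinv {x : V} (hx : x ∈ T.term.vars ∪ ρ.vars) : ε (δ x) = x :=
    h.left_inv_of_mem h' hdT hdS hx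
  have hconstr := hst.redex.subst_renameMatch h hdT (u := ρ.constr) fun _ hx => .inr hx
  have htarget : ReplaceAt S.term p (ρ.rhs.subst (ρ.renameMatch γ δ)) (T'.term.rename δ) := by
    rw [hst.redex.subst_renameMatch h hdT fun _ hx => .inl (.inr hx), h.term_eq]
    exact hst.target.rename δ
  let c := M.conj S.ec.constr (ρ.constr.subst (ρ.renameMatch γ δ))
  let t := T'.term.rename δ
  let S' : ECTerm F V := ⟨ρ.exVars ∪ (S.lvars ∩ t.vars), t, ⟨c.vars \ t.vars, c⟩⟩
  have hst' : MGStepData M ρ S S' p (ρ.renameMatch γ δ) :=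
    ⟨hst.redex.renames hρ hT hdT hdS h h', htarget, rfl, rfl, rfl⟩
  refine ⟨S', hst'.wf hρ hS hdS,
    ⟨hst.subsumedBy hρ hT hS hdT hdS h h' hst' rfl hconstr,
      hst'.subsumedBy hρ hS hT hdS hdT h' h hst ?_ ?_⟩, p, _, hst'⟩
  · exact (Term.rename_rename_of_inverse fun x hx => hinv <|
      Set.union_subset_union_right _ Rule.exVars_subset_vars (hst.vars_term_subset hx)).symm
  · rw [hconstr, Term.rename_rename_of_inverse fun x hx =>
      hinv (hst.vars_constr_subst_subset hρ hT hx)]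

end

end LCTRS
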